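/- Let d ≥ 1, k ≥ 2, κ : Fin d → ℝ, and let v_k(κ) be the real matrix with rows indexed by functions f : Fin (k-1) → Fin d and columns indexed by Fin d, whose (f, m) entry equals κ(m) if f is constantly equal to m and 0 otherwise. Let Ω be a real symmetric positive definite d × d matrix and Ω^{⊗(k-1)} its (k-1)-fold Kronecker power (entry (f,g) equal to the product over j of Ω(f(j), g(j))). Let D be an invertible complex d × d matrix. Then the complex matrix D · (v_k(κ)ᵀ Ω^{⊗(k-1)} v_k(κ)) · Dᴴ (where the real middle factor is viewed as a complex matrix and Dᴴ is the conjugate transpose) has rank equal to the number of indices m with κ(m) ≠ 0. -/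

import Mathlib

open Matrix

lemma hadamard_pow_posDef {d : ℕ} (Ω : Matrix (Fin d) (Fin d) ℝ) (hΩ : Ω.PosDef) (n : ℕ) :
    (Matrix.of fun a b => Ω a b ^ (n + 1)).PosDef := by
  induction n with
  | zero =>
    simp only [zero_add, pow_one]
    exact hΩ
  | succ n ih =>
    have h := ih.hadamard hΩ
    have e : (Matrix.of fun a b => Ω a b ^ (n + 1 + 1)) =
        (Matrix.of fun a b => Ω a b ^ (n + 1)) ⊙ Ω := by
      ext a b
      simp [Matrix.hadamard_apply, pow_succ]
    rw [e]
    exact h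

lemma middle_eq {d n : ℕ} (κ : Fin d → ℝ) (Ω : Matrix (Fin d) (Fin d) ℝ) :
    ((Matrix.of fun (f : Fin n → Fin d) (m : Fin d) =>
              if f = Function.const (Fin n) m then κ m else 0)ᵀ *
            (Matrix.of fun f g : Fin n → Fin d => ∏ j, Ω (f j) (g j)) *
            (Matrix.of fun (f : Fin n → Fin d) (m : Fin d) =>
              if f = Function.const (Fin n) m then κ m else 0)) =
    diagonal κ * (Matrix.of fun a b => Ω a b ^ n) * diagonal κ := by
  ext a b
  rw [mul_diagonal, diagonal_mul]
  simp [Matrix.mul_apply]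

open scoped ComplexOrder in
lemma rank_middle {d : ℕ} (κ : Fin d → ℝ) (H : Matrix (Fin d) (Fin d) ℝ) (hH : H.PosDef) :
    ((diagonal κ * H * diagonal κ).map Complex.ofReal).rank =
      (Finset.univ.filter fun m : Fin d => κ m ≠ 0).card := by
  open scoped MatrixOrder Matrix.Norms.L2Operator in
  obtain ⟨B, hB⟩ := CStarAlgebra.nonneg_iff_eq_star_mul_self.mp hH.posSemidef.nonneg
  rw [star_eq_conjTranspose] at hB
  have hBu : IsUnit B.det := by
    have h := hH.det_pos
    rw [hB, det_mul] at h
    exact isUnit_iff_ne_zero.mpr fun h0 => by simp [h0] at h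
  have hCu : IsUnit (B.map Complex.ofReal).det := by
    have := hBu.map Complex.ofRealHom
    rw [RingHom.map_det] at this
    exact this
  have e : (diagonal κ * H * diagonal κ).map Complex.ofReal =
      (B.map Complex.ofReal * diagonal fun i => (κ i : ℂ))ᴴ *
      (B.map Complex.ofReal * diagonal fun i => (κ i : ℂ)) := by
    rw [hB]
    ext a b
    simp [Matrix.mul_apply, diagonal_apply, Finset.mul_sum, Finset.sum_mul]
    refine Finset.sum_congr rfl fun i _ => by ring
  rw [e, rank_conjTranspose_mul_self, rank_mul_eq_right_of_isUnit_det _ _ hCu, rank_diagonal,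
    Fintype.card_subtype]
  simp

/-- Algebraic core of Proposition 1: for the cumulant matrix `v_k(κ)`, a symmetric
positive definite `Ω` with Kronecker power `Ω^{⊗(k-1)}`, and an invertible complex
matrix `D`, the matrix `D (v_kᵀ Ω^{⊗(k-1)} v_k) Dᴴ` has rank equal to the number of
nonzero marginal cumulants `κ m`. -/
theorem stmt_5 (d k : ℕ) (hd : 1 ≤ d) (hk : 2 ≤ k) (κ : Fin d → ℝ)
    (Ω : Matrix (Fin d) (Fin d) ℝ) (hΩ : Ω.PosDef)
    (D : Matrix (Fin d) (Fin d) ℂ) (hD : IsUnit D) :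
    (D *
        ((Matrix.of fun (f : Fin (k - 1) → Fin d) (m : Fin d) =>
              if f = Function.const (Fin (k - 1)) m then κ m else 0)ᵀ *
            (Matrix.of fun f g : Fin (k - 1) → Fin d => ∏ j, Ω (f j) (g j)) *
            (Matrix.of fun (f : Fin (k - 1) → Fin d) (m : Fin d) =>
              if f = Function.const (Fin (k - 1)) m then κ m else 0)).map
          (Complex.ofReal) *
        Dᴴ).rank =
      (Finset.univ.filter fun m : Fin d => κ m ≠ 0).card := by
  have hDd : IsUnit D.det := (Matrix.isUnit_iff_isUnit_det D).mp hD
  have hDd' : IsUnit Dᴴ.det := by rw [det_conjTranspose]; exact hDd.star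
  rw [rank_mul_eq_left_of_isUnit_det _ _ hDd', rank_mul_eq_right_of_isUnit_det _ _ hDd,
    middle_eq]
  obtain ⟨n, rfl⟩ : ∃ n, k = n + 2 := ⟨k - 2, by omega⟩
  exact rank_middle κ _ (hadamard_pow_posDef Ω hΩ n)
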